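/- The split strength of the partition of the positive integers into the even numbers 2ℕ = {2,4,6,…} and the odd numbers satisfies 0 ≤ φ(2ℕ, complement of 2ℕ) ≤ 1/2. -/

import Mathlib

open Filter

/-- Two permutations of `[n]` are `G(D)`-different if at some position the
absolute difference of their values lies in `D`. `T n D` is the maximum
cardinality of a set of pairwise `G(D)`-different permutations of `[n]`. -/
noncomputable def T (n : ℕ) (D : Set ℕ) : ℕ :=
  sSup {k | ∃ S : Finset (Equiv.Perm (Fin n)), S.card = k ∧
    ∀ π ∈ S, ∀ σ ∈ S, π ≠ σ →
      ∃ i : Fin n, ((π i : ℤ) - (σ i : ℤ)).natAbs ∈ D}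

/-- The split strength `φ(D, D̄) = limsup (1/n) log₂ (T(n,D)·T(n,D̄)/n!)`. -/
noncomputable def splitStrength (D Dc : Set ℕ) : ℝ :=
  Filter.atTop.limsup fun n : ℕ =>
    Real.logb 2 ((T n D : ℝ) * (T n Dc : ℝ) / (Nat.factorial n : ℝ)) / n

/-- A family of pairwise `G(D)`-different permutations has at most `T n D` members. -/
lemma card_le_T {n : ℕ} {D : Set ℕ} (S : Finset (Equiv.Perm (Fin n)))
    (hS : ∀ π ∈ S, ∀ σ ∈ S, π ≠ σ → ∃ i : Fin n, ((π i : ℤ) - (σ i : ℤ)).natAbs ∈ D) :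
    S.card ≤ T n D := by
  refine le_csSup ⟨Fintype.card (Equiv.Perm (Fin n)), ?_⟩ ⟨S, rfl, hS⟩
  rintro k ⟨S', rfl, -⟩
  exact S'.card_le_univ

/-- The maximum defining `T n D` is attained. -/
lemma exists_card_eq_T (n : ℕ) (D : Set ℕ) :
    ∃ S : Finset (Equiv.Perm (Fin n)), S.card = T n D ∧
      ∀ π ∈ S, ∀ σ ∈ S, π ≠ σ → ∃ i : Fin n, ((π i : ℤ) - (σ i : ℤ)).natAbs ∈ D := by
  refine Nat.sSup_mem (s := {k | ∃ S : Finset (Equiv.Perm (Fin n)), S.card = k ∧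
    ∀ π ∈ S, ∀ σ ∈ S, π ≠ σ → ∃ i : Fin n, ((π i : ℤ) - (σ i : ℤ)).natAbs ∈ D})
    ⟨0, ∅, by simp⟩ ⟨Fintype.card (Equiv.Perm (Fin n)), ?_⟩
  rintro k ⟨S', rfl, -⟩
  exact S'.card_le_univ

/-- The parity pattern of a permutation. -/
def parityPattern {n : ℕ} (π : Equiv.Perm (Fin n)) : Fin n → Bool :=
  fun i => decide (Even (π i : ℕ))

lemma parityPattern_ne_iff {n : ℕ} (π σ : Equiv.Perm (Fin n)) :
    parityPattern π ≠ parityPattern σ ↔ ∃ i, Odd ((π i : ℤ) - (σ i : ℤ)).natAbs := by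
  rw [Function.ne_iff]
  refine exists_congr fun i => ?_
  rw [Int.natAbs_odd, ← Int.not_even_iff_odd, Int.even_sub, Int.even_coe_nat, Int.even_coe_nat]
  simp [parityPattern]

lemma T_odd_le (n : ℕ) : T n {d : ℕ | Odd d} ≤ 2 ^ n := by
  obtain ⟨S, hcard, hS⟩ := exists_card_eq_T n {d : ℕ | Odd d}
  have h : S.card ≤ (Finset.univ : Finset (Fin n → Bool)).card := by
    refine Finset.card_le_card_of_injOn parityPattern (by simp) fun π hπ σ hσ h => ?_
    by_contra hne
    exact (parityPattern_ne_iff π σ).2 (hS π hπ σ hσ hne) h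
  simpa [← hcard] using h

lemma factorial_le_T_mul_T (n : ℕ) :
    n.factorial ≤ T n {d : ℕ | 0 < d ∧ Even d} * T n {d : ℕ | Odd d} := by
  classical
  have hfiber : ∀ b ∈ Finset.univ.image (parityPattern (n := n)),
      (Finset.univ.filter fun π => parityPattern π = b).card ≤ T n {d : ℕ | 0 < d ∧ Even d} := by
    intro b _
    refine card_le_T _ fun π hπ σ hσ hne => ?_
    obtain ⟨i, hi⟩ := DFunLike.ne_iff.1 hne
    have heq : parityPattern π = parityPattern σ := by simp_all
    have hnot := fun h => (parityPattern_ne_iff π σ).2 h heq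
    refine ⟨i, ?_, Nat.not_odd_iff_even.1 fun h => hnot ⟨i, h⟩⟩
    have : (π i : ℕ) ≠ σ i := fun h => hi (Fin.ext h)
    omega
  have himage : (Finset.univ.image (parityPattern (n := n))).card ≤ T n {d : ℕ | Odd d} := by
    obtain ⟨S, -, hinj, himg⟩ := Finset.exists_subset_injOn_image_eq_of_surjOn
      (f := parityPattern (n := n)) Set.univ (Finset.univ.image (parityPattern (n := n)))
      (by intro b hb; simpa using hb)
    rw [← himg, Finset.card_image_of_injOn hinj]
    refine card_le_T S fun π hπ σ hσ hne => (parityPattern_ne_iff π σ).1 fun h => hne ?_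
    exact hinj hπ hσ h
  calc n.factorial = (Finset.univ : Finset (Equiv.Perm (Fin n))).card := by
        simp [Fintype.card_perm]
    _ ≤ T n {d : ℕ | 0 < d ∧ Even d} * (Finset.univ.image (parityPattern (n := n))).card :=
        Finset.card_le_mul_card_image _ _ hfiber
    _ ≤ _ := Nat.mul_le_mul_left _ himage

/-- The map of `Fin n` exchanging `2k` and `2k + 1` for those `k < n / 2` at which `s` is true. -/
def pairSwapFun {n : ℕ} (s : Fin (n / 2) → Bool) (v : Fin n) : Fin n :=
  if h : (v : ℕ) / 2 < n / 2 then
    if s ⟨(v : ℕ) / 2, h⟩ then ⟨4 * ((v : ℕ) / 2) + 1 - v, by omega⟩ else v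
  else v

lemma pairSwapFun_div_two {n : ℕ} (s : Fin (n / 2) → Bool) (v : Fin n) :
    (pairSwapFun s v : ℕ) / 2 = (v : ℕ) / 2 := by
  unfold pairSwapFun
  split_ifs
  · simp only
    omega
  · rfl
  · rfl

lemma pairSwapFun_involutive {n : ℕ} (s : Fin (n / 2) → Bool) :
    Function.Involutive (pairSwapFun s) := by
  intro v
  have hdiv := pairSwapFun_div_two s v
  by_cases h : (v : ℕ) / 2 < n / 2
  · by_cases hs : s ⟨(v : ℕ) / 2, h⟩
    · have hval : ∀ w : Fin n, (w : ℕ) / 2 = (v : ℕ) / 2 →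
          (pairSwapFun s w : ℕ) = 4 * ((v : ℕ) / 2) + 1 - w := by
        intro w hw
        simp [pairSwapFun, hw, h, hs]
      ext
      rw [hval _ hdiv, hval v rfl]
      omega
    · simp [pairSwapFun, h, hs]
  · simp [pairSwapFun, h]

/-- The permutation exchanging `2k` and `2k + 1` for those `k < n / 2` at which `s` is true. -/
def pairSwap {n : ℕ} (s : Fin (n / 2) → Bool) : Equiv.Perm (Fin n) :=
  (pairSwapFun_involutive s).toPerm

lemma pairSwap_div_two {n : ℕ} (s : Fin (n / 2) → Bool) (v : Fin n) :
    (pairSwap s v : ℕ) / 2 = (v : ℕ) / 2 :=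
  pairSwapFun_div_two s v

lemma pairSwap_injective {n : ℕ} : Function.Injective (pairSwap (n := n)) := by
  intro s t h
  funext k
  have hk : (2 * (k : ℕ)) / 2 = k := by omega
  have hv := congrArg Fin.val (DFunLike.congr_fun h (⟨2 * k, by omega⟩ : Fin n))
  simp only [pairSwap, Function.Involutive.coe_toPerm, pairSwapFun, hk, k.isLt, dite_true,
    Fin.eta] at hv
  cases hs : s k <;> cases ht : t k <;> simp [hs, ht] at hv ⊢ <;> omega

lemma T_even_mul_le (n : ℕ) :
    T n {d : ℕ | 0 < d ∧ Even d} * 2 ^ (n / 2) ≤ n.factorial := by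
  obtain ⟨S, hcard, hS⟩ := exists_card_eq_T n {d : ℕ | 0 < d ∧ Even d}
  have h : (S ×ˢ (Finset.univ : Finset (Fin (n / 2) → Bool))).card ≤
      (Finset.univ : Finset (Equiv.Perm (Fin n))).card := by
    refine Finset.card_le_card_of_injOn (fun p => pairSwap p.2 * p.1) (by simp) ?_
    rintro ⟨π, s⟩ hp ⟨σ, t⟩ hq heq
    simp only [Finset.coe_product, Set.mem_prod, Finset.mem_coe] at hp hq
    have hπσ : π = σ := by
      by_contra hne
      obtain ⟨i, hpos, heven⟩ := hS π hp.1 σ hq.1 hne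
      have hi := congrArg Fin.val (DFunLike.congr_fun heq i)
      simp only [Equiv.Perm.mul_apply] at hi
      have h1 := pairSwap_div_two s (π i)
      have h2 := pairSwap_div_two t (σ i)
      rw [Nat.even_iff] at heven
      omega
    subst hπσ
    exact Prod.ext rfl (pairSwap_injective (mul_right_cancel heq))
  simpa [Finset.card_product, Fintype.card_perm, hcard] using h

lemma logb_T_mul_T_nonneg (n : ℕ) :
    0 ≤ Real.logb 2 ((T n {d : ℕ | 0 < d ∧ Even d} : ℝ) * (T n {d : ℕ | Odd d} : ℝ) /
      (Nat.factorial n : ℝ)) := by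
  refine Real.logb_nonneg one_lt_two ?_
  rw [one_le_div (by positivity)]
  exact_mod_cast factorial_le_T_mul_T n

lemma logb_T_mul_T_le (n : ℕ) :
    Real.logb 2 ((T n {d : ℕ | 0 < d ∧ Even d} : ℝ) * (T n {d : ℕ | Odd d} : ℝ) /
      (Nat.factorial n : ℝ)) ≤ (n + 1 : ℝ) / 2 := by
  have hprod : T n {d : ℕ | 0 < d ∧ Even d} * T n {d : ℕ | Odd d} ≤
      2 ^ (n - n / 2) * n.factorial := by
    refine Nat.le_of_mul_le_mul_right ?_ (Nat.two_pow_pos (n / 2))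
    calc T n {d : ℕ | 0 < d ∧ Even d} * T n {d : ℕ | Odd d} * 2 ^ (n / 2)
        = (T n {d : ℕ | 0 < d ∧ Even d} * 2 ^ (n / 2)) * T n {d : ℕ | Odd d} := by ring
      _ ≤ n.factorial * 2 ^ n := Nat.mul_le_mul (T_even_mul_le n) (T_odd_le n)
      _ = n.factorial * (2 ^ (n - n / 2) * 2 ^ (n / 2)) := by
        rw [← pow_add, Nat.sub_add_cancel (Nat.div_le_self n 2)]
      _ = 2 ^ (n - n / 2) * n.factorial * 2 ^ (n / 2) := by ring
  have hpos : 0 < T n {d : ℕ | 0 < d ∧ Even d} * T n {d : ℕ | Odd d} :=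
    n.factorial_pos.trans_le (factorial_le_T_mul_T n)
  have hexp : ((n - n / 2 : ℕ) : ℝ) ≤ (n + 1 : ℝ) / 2 := by
    rw [le_div_iff₀ two_pos]
    exact_mod_cast (by omega : (n - n / 2) * 2 ≤ n + 1)
  refine le_trans ?_ hexp
  rw [Real.logb_le_iff_le_rpow one_lt_two (div_pos (by exact_mod_cast hpos) (by positivity)),
    Real.rpow_natCast, div_le_iff₀ (by positivity)]
  exact_mod_cast hprod

/-- Corollary: `0 ≤ φ(2ℕ, complement of 2ℕ) ≤ 1/2`, where `2ℕ` is the set of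
even positive integers and its complement is the set of odd positive integers. -/
theorem splitStrength_even :
    0 ≤ splitStrength {d : ℕ | 0 < d ∧ Even d} {d : ℕ | Odd d} ∧
    splitStrength {d : ℕ | 0 < d ∧ Even d} {d : ℕ | Odd d} ≤ 1 / 2 := by
  have hlim : Tendsto (fun n : ℕ => (n + 1 : ℝ) / 2 / n) atTop (nhds (1 / 2)) := by
    have h := (tendsto_const_nhds (x := (1 / 2 : ℝ))).add
      ((tendsto_one_div_atTop_nhds_zero_nat (𝕜 := ℝ)).const_mul (1 / 2))
    rw [mul_zero, add_zero] at h
    refine h.congr' ?_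
    filter_upwards [eventually_gt_atTop 0] with n hn
    field_simp
  have hle : ∀ n : ℕ, Real.logb 2 ((T n {d : ℕ | 0 < d ∧ Even d} : ℝ) *
      (T n {d : ℕ | Odd d} : ℝ) / (Nat.factorial n : ℝ)) / n ≤ (n + 1 : ℝ) / 2 / n :=
    fun n => div_le_div_of_nonneg_right (logb_T_mul_T_le n) n.cast_nonneg
  have hnonneg : ∀ n : ℕ, 0 ≤ Real.logb 2 ((T n {d : ℕ | 0 < d ∧ Even d} : ℝ) *
      (T n {d : ℕ | Odd d} : ℝ) / (Nat.factorial n : ℝ)) / n :=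
    fun n => div_nonneg (logb_T_mul_T_nonneg n) n.cast_nonneg
  constructor
  · exact le_limsup_of_frequently_le (Frequently.of_forall hnonneg)
      (hlim.isBoundedUnder_le.mono_le (Eventually.of_forall hle))
  · rw [← hlim.limsup_eq]
    exact limsup_le_limsup (Eventually.of_forall hle)
      (isCoboundedUnder_le_of_le atTop hnonneg) hlim.isBoundedUnder_le
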